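/- arXiv:2210.14733 — 2 statements merged into one kernel-verified Lean document; each statement's English description precedes it below -/
import Mathlib

section
/- Sampling lemma, non-archimedean case: Let K be an algebraically closed field equipped with a nontrivial non-archimedean absolute value |·| (multiplicative, satisfying the ultrametric inequality, with |x| ∉ {0,1} for some nonzero x). Let q_1,…,q_m ∈ K[s] be nonzero polynomials. Then the set {t ∈ K : |t| = 1 and |q_i(t)| = ‖q_i‖ for all i = 1,…,m} is infinite. -/
/-- The Gauss norm of a polynomial over `K`, with respect to an absolute value
`a : K → ℝ`: the maximum of the `a`-values of its coefficients. -/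
noncomputable def polyVNorm {K : Type*} [Semiring K] (a : K → ℝ) (q : Polynomial K) :
    NNReal :=
  q.support.sup fun j => (a (q.coeff j)).toNNReal

open Polynomial in
theorem polyVNorm_eq_gaussNorm {K : Type*} [Ring K] (v : AbsoluteValue K ℝ) (q : K[X]) :
    (polyVNorm (fun x => v x) q : ℝ) = q.gaussNorm v 1 := by
  apply le_antisymm
  · have h : polyVNorm (fun x => v x) q ≤ (q.gaussNorm v 1).toNNReal :=
      Finset.sup_le fun j _ => Real.toNNReal_le_toNNReal (by
        simpa using q.le_gaussNorm v zero_le_one j)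
    exact (NNReal.coe_le_coe.2 h).trans_eq (Real.coe_toNNReal _ (q.gaussNorm_nonneg v zero_le_one))
  · obtain ⟨i, hi⟩ := q.exists_eq_gaussNorm v 1
    rw [hi, one_pow, mul_one]
    by_cases h0 : q.coeff i = 0
    · simp [h0]
    · exact Real.toNNReal_le_iff_le_coe.1
        (Finset.le_sup (f := fun j => (v (q.coeff j)).toNNReal) (mem_support_iff.2 h0))

theorem AbsoluteValue.map_sub_eq_right_of_lt {K : Type*} [Ring K] {v : AbsoluteValue K ℝ}
    (hna : IsNonarchimedean v) {x y : K} (h : v x < v y) : v (x - y) = v y := by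
  rw [v.map_sub, ← IsNonarchimedean.add_eq_left_of_lt hna (x := y) (y := -x) (by rwa [v.map_neg]),
    sub_eq_add_neg]

open Polynomial in
theorem gaussNorm_one_X_sub_C {K : Type*} [Field K] {v : AbsoluteValue K ℝ}
    (hna : IsNonarchimedean v) (a : K) : (X - C a).gaussNorm v 1 = max 1 (v a) := by
  apply le_antisymm
  · have h := isNonarchimedean_gaussNorm v hna zero_le_one (monomial 1 1) (C (-a))
    rw [gaussNorm_monomial, gaussNorm_C, monomial_one_one_eq_X, C_neg, ← sub_eq_add_neg] at h
    simpa using h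
  · have h0 := (X - C a).le_gaussNorm v zero_le_one 0
    have h1 := (X - C a).le_gaussNorm v zero_le_one 1
    exact max_le (by simpa [coeff_C] using h1) (by simpa using h0)

open Polynomial in
/-- If `t` realizes the Gauss norm of every linear factor of a split polynomial, it realizes the
Gauss norm of the polynomial. -/
theorem Polynomial.Splits.map_eval_eq_gaussNorm {K : Type*} [Field K] {v : AbsoluteValue K ℝ}
    (hna : IsNonarchimedean v) {q : K[X]} (hq : q.Splits) {t : K}
    (ht : ∀ a ∈ q.roots, v (t - a) = max 1 (v a)) : v (q.eval t) = q.gaussNorm v 1 := by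
  have h (s : Multiset K) (hs : ∀ a ∈ s, v (t - a) = max 1 (v a)) :
      v (s.map (t - ·)).prod = (s.map (X - C ·)).prod.gaussNorm v 1 := by
    induction s using Multiset.induction with
    | empty => simp [← C_1, -map_one]
    | cons a s ih =>
      rw [Multiset.map_cons, Multiset.map_cons, Multiset.prod_cons, Multiset.prod_cons, v.map_mul,
        gaussNorm_mul hna one_pos, gaussNorm_one_X_sub_C hna, hs a (Multiset.mem_cons_self a s),
        ih fun b hb => hs b (Multiset.mem_cons_of_mem hb)]
  rw [hq.eval_eq_prod_roots, v.map_mul, h _ ht]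
  conv_rhs => rw [hq.eq_prod_roots, gaussNorm_mul hna one_pos, gaussNorm_C]

open Polynomial in
/-- A finite set of integral elements does not meet every residue class: a root of
`∏ a ∈ T, (X - a) - 1` lies in the residue class of no element of `T`. -/
theorem IsNonarchimedean.exists_map_sub_eq_one {K : Type*} [Field K] [IsAlgClosed K]
    {v : AbsoluteValue K ℝ} (hna : IsNonarchimedean v) (T : Finset K) (hT : ∀ a ∈ T, v a ≤ 1) :
    ∃ t, ∀ a ∈ T, v (t - a) = 1 := by
  classical
  rcases T.eq_empty_or_nonempty with rfl | hne
  · simp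
  have hpos : 0 < (∏ a ∈ T, (X - C a)).degree := by
    simpa [degree_prod, Finset.card_pos] using hne
  obtain ⟨t, ht⟩ := IsAlgClosed.exists_root (∏ a ∈ T, (X - C a) - C 1) (by
    rw [degree_sub_C hpos]; exact hpos.ne')
  have hprod : ∏ a ∈ T, v (t - a) = 1 := by
    have h : ∏ a ∈ T, (t - a) = 1 := by
      simpa [IsRoot, eval_prod, sub_eq_zero] using ht
    rw [← map_prod, h, v.map_one]
  have ht1 : v t ≤ 1 := by
    by_contra! hlt
    have h (a) (ha : a ∈ T) : 1 < v (t - a) := by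
      rw [v.map_sub, AbsoluteValue.map_sub_eq_right_of_lt hna ((hT a ha).trans_lt hlt)]
      exact hlt
    have := Finset.prod_lt_prod_of_nonempty (fun a _ => one_pos) h hne
    simp [hprod] at this
  have hle (a) (ha : a ∈ T) : v (t - a) ≤ 1 := by
    have := hna t (-a)
    rw [← sub_eq_add_neg, v.map_neg] at this
    exact this.trans (max_le ht1 (hT a ha))
  refine ⟨t, fun a ha => (hle a ha).antisymm ?_⟩
  rw [← hprod, ← Finset.mul_prod_erase T _ ha]
  exact mul_le_of_le_one_right (v.nonneg _) (Finset.prod_le_one (fun b _ => v.nonneg _)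
    fun b hb => hle b (Finset.mem_of_mem_erase hb))

/-- **Sampling lemma, non-archimedean case.**  Let `K` be an algebraically closed field
with a nontrivial non-archimedean absolute value `v`, and let `q₁, …, q_m ∈ K[s]` be
nonzero polynomials.  Then there are infinitely many `t ∈ K` with `|t| = 1` such that
`|qᵢ(t)| = ‖qᵢ‖` (the Gauss norm) for every `i`. -/
theorem sampling_nonarchimedean
    (K : Type*) [Field K] [IsAlgClosed K]
    (v : AbsoluteValue K ℝ)
    (hna : ∀ x y : K, v (x + y) ≤ max (v x) (v y))
    (hnt : ∃ x : K, x ≠ 0 ∧ v x ≠ 1)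
    (m : ℕ) (q : Fin m → Polynomial K) (hq : ∀ i, q i ≠ 0) :
    {t : K | v t = 1 ∧
      ∀ i, v ((q i).eval t) = (polyVNorm (fun x => v x) (q i) : ℝ)}.Infinite := by
  classical
  replace hna : IsNonarchimedean v := hna
  intro hfin
  let R : Finset K := Finset.univ.biUnion fun i => (q i).roots.toFinset
  obtain ⟨t, ht⟩ := hna.exists_map_sub_eq_one (insert 0 (hfin.toFinset ∪ R.filter (v · ≤ 1))) (by
    intro a ha
    simp only [Finset.mem_insert, Finset.mem_union, Finset.mem_filter,
      Set.Finite.mem_toFinset] at ha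
    rcases ha with rfl | ha | ha
    · simp
    · exact ha.1.le
    · exact ha.2)
  have ht1 : v t = 1 := by simpa using ht 0 (Finset.mem_insert_self _ _)
  have hmem : t ∈ {t : K | v t = 1 ∧
      ∀ i, v ((q i).eval t) = (polyVNorm (fun x => v x) (q i) : ℝ)} := by
    refine ⟨ht1, fun i => ?_⟩
    rw [polyVNorm_eq_gaussNorm]
    refine (IsAlgClosed.splits (q i)).map_eval_eq_gaussNorm hna fun a ha => ?_
    rcases le_or_gt (v a) 1 with h | h
    · rw [max_eq_left h]
      exact ht a (Finset.mem_insert_of_mem (Finset.mem_union_right _ (Finset.mem_filter.2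
        ⟨Finset.mem_biUnion.2 ⟨i, Finset.mem_univ i, Multiset.mem_toFinset.2 ha⟩, h⟩)))
    · rw [max_eq_right h.le, AbsoluteValue.map_sub_eq_right_of_lt hna (ht1 ▸ h)]
  simpa using ht t (Finset.mem_insert_of_mem (Finset.mem_union_left _ (hfin.mem_toFinset.2 hmem)))
end

section
/- Effective Bézout identities with uniform local bounds: Let K be a number field and let ψ_1,…,ψ_M ∈ K[s] be polynomials, not all zero, whose greatest common divisor in K[s] is 1. Let D = max_i deg(ψ_i) and suppose D ≥ 1. Then there exist a positive integer r ≤ 4D, a nonzero element a ∈ K, and polynomials g_1,…,g_M, h_1,…,h_M ∈ K[s], each of degree at most D − 1, such that a·s^{2D−1} = Σ_{i=1}^M ψ_i·g_i and a = Σ_{i=1}^M ψ_i·h_i, and such that for every place v ∈ M_K: log|a|_v ≤ r·log⁺(max_i‖ψ_i‖_v) + r·log⁺|r|_v, and log‖g_i‖_v ≤ r·log⁺(max_i‖ψ_i‖_v) + r·log⁺|r|_v and log‖h_i‖_v ≤ r·log⁺(max_i‖ψ_i‖_v) + r·log⁺|r|_v for all i (here the integer r is regarded as an element of K). -/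
open Finset in
/-- Base-`N` expansion bound for the size of a natural number under an absolute value. -/
lemma AbsoluteValue.natCast_le_of_le_pow {K : Type*} [Field K] (f : AbsoluteValue K ℝ)
    {N : ℕ} (hN : 1 ≤ N) (k : ℕ) {m : ℕ} (hm : m ≤ N ^ k) :
    f (m : K) ≤ (k + 1) * N * max 1 (f (N : K)) ^ k := by
  have hnat : ∀ r : ℕ, f (r : K) ≤ r := by
    intro r
    induction r with
    | zero => simp
    | succ r ih =>
      push_cast
      exact (f.add_le _ _).trans (by simpa using ih)
  have hN' : (1 : ℝ) ≤ N := by exact_mod_cast hN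
  induction k generalizing m with
  | zero =>
    have h1 : (m : ℝ) ≤ 1 := by exact_mod_cast (by simpa using hm)
    have := hnat m
    simp only [CharP.cast_eq_zero, zero_add, one_mul, pow_zero, mul_one]
    linarith
  | succ k ih =>
    set c := max 1 (f (N : K)) with hc
    have hc1 : 1 ≤ c := le_max_left _ _
    have hq : m / N ≤ N ^ k := Nat.div_le_of_le_mul (by rw [← pow_succ']; exact hm)
    have hr : ((m % N : ℕ) : ℝ) ≤ N := by exact_mod_cast (Nat.mod_lt m hN).le
    have hsplit : (m : K) = (N : K) * ((m / N : ℕ) : K) + ((m % N : ℕ) : K) := by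
      rw [← Nat.cast_mul, ← Nat.cast_add, Nat.div_add_mod]
    have hck : 1 ≤ c ^ (k + 1) := one_le_pow₀ hc1
    calc f (m : K) ≤ f (N : K) * f ((m / N : ℕ) : K) + f ((m % N : ℕ) : K) := by
          rw [hsplit, ← f.map_mul]; exact f.add_le _ _
      _ ≤ c * ((k + 1) * N * c ^ k) + N * c ^ (k + 1) := by
          refine add_le_add (mul_le_mul (le_max_right _ _) (ih hq) (f.nonneg _) (by positivity)) ?_
          have := hnat (m % N)
          nlinarith
      _ = ((k + 1 : ℕ) + 1) * N * c ^ (k + 1) := by push_cast; ring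

/-- A polynomial factor is invisible to exponential growth rates. -/
lemma le_of_forall_pow_le_mul_pow {y z C : ℝ} (hz : 0 < z) (d : ℕ)
    (h : ∀ n : ℕ, y ^ n ≤ C * ((n : ℝ) + 1) ^ d * z ^ n) : y ≤ z := by
  by_contra! hlt
  have hq : 1 < y / z := (one_lt_div hz).2 hlt
  have hq0 : 0 < y / z := by linarith
  have ht := (tendsto_pow_const_div_const_pow_of_one_lt d hq).comp
    (Filter.tendsto_add_atTop_nat 1)
  have ht' := ht.const_mul (C * (y / z))
  rw [mul_zero] at ht'
  obtain ⟨n, hn⟩ := (ht'.eventually (gt_mem_nhds one_pos)).exists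
  have h1 : (y / z) ^ n ≤ C * ((n : ℝ) + 1) ^ d := by
    rw [div_pow, div_le_iff₀ (by positivity)]
    exact h n
  have h2 : C * (y / z) * (((n : ℝ) + 1) ^ d / (y / z) ^ (n + 1)) =
      C * ((n : ℝ) + 1) ^ d / (y / z) ^ n := by
    have hy : y ≠ 0 := (hz.trans hlt).ne'
    rw [pow_succ]
    field_simp
  simp only [Function.comp_apply, Nat.cast_add, Nat.cast_one] at hn
  rw [h2, div_lt_one (by positivity)] at hn
  linarith

open Finset in
lemma AbsoluteValue.sum_le_of_card_le_pow {K : Type*} [Field K] (f : AbsoluteValue K ℝ)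
    {ι : Type*} [Fintype ι] {N k : ℕ} (hN : 1 ≤ N) (hcard : Fintype.card ι ≤ N ^ k)
    (x : ι → K) {B : ℝ} (hB : 0 < B) (hx : ∀ i, f (x i) ≤ B) :
    f (∑ i, x i) ≤ max 1 (f (N : K)) ^ k * B := by
  classical
  set c := max 1 (f (N : K)) with hc
  have hc1 : 1 ≤ c := le_max_left _ _
  refine le_of_forall_pow_le_mul_pow (C := (k + 1) * N) (by positivity)
    (Fintype.card ι + 1) fun n => ?_
  have hmult : ∀ e ∈ piAntidiag (univ : Finset ι) n, Nat.multinomial univ e ≤ N ^ (k * n) := by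
    intro e he
    have h1 := Finset.sum_pow_eq_sum_piAntidiag (univ : Finset ι) (fun _ => (1 : ℕ)) n
    simp only [sum_const, card_univ, smul_eq_mul, mul_one, one_pow, prod_const_one,
      Nat.cast_id] at h1
    calc Nat.multinomial univ e ≤ ∑ e ∈ piAntidiag (univ : Finset ι) n, Nat.multinomial univ e :=
          single_le_sum (f := fun e => Nat.multinomial univ e) (fun _ _ => Nat.zero_le _) he
      _ = Fintype.card ι ^ n := h1.symm
      _ ≤ (N ^ k) ^ n := Nat.pow_le_pow_left hcard n
      _ = N ^ (k * n) := (pow_mul _ _ _).symm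
  have hterm : ∀ e ∈ piAntidiag (univ : Finset ι) n,
      f ((Nat.multinomial univ e : K) * ∏ i, x i ^ e i) ≤
        (((k * n : ℕ) : ℝ) + 1) * N * c ^ (k * n) * B ^ n := by
    intro e he
    rw [f.map_mul, map_prod]
    refine mul_le_mul (f.natCast_le_of_le_pow hN _ (hmult e he)) ?_
      (prod_nonneg fun i _ => f.nonneg _) (by positivity)
    have hsum : ∑ i, e i = n := (mem_piAntidiag.1 he).1
    calc ∏ i, f (x i ^ e i) ≤ ∏ i, B ^ e i := by
          refine prod_le_prod (fun i _ => f.nonneg _) fun i _ => ?_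
          rw [map_pow]
          exact pow_le_pow_left₀ (f.nonneg _) (hx i) _
      _ = B ^ n := by rw [prod_pow_eq_pow_sum, hsum]
  have hcount : #(piAntidiag (univ : Finset ι) n) ≤ (n + 1) ^ Fintype.card ι := by
    have hsub : piAntidiag (univ : Finset ι) n ⊆ Fintype.piFinset fun _ => range (n + 1) := by
      intro e he
      rw [Fintype.mem_piFinset]
      intro i
      have hsum : ∑ i, e i = n := (mem_piAntidiag.1 he).1
      rw [mem_range, Nat.lt_succ_iff, ← hsum]
      exact single_le_sum (fun _ _ => Nat.zero_le _) (mem_univ i)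
    simpa using card_le_card hsub
  have hcount' : (#(piAntidiag (univ : Finset ι) n) : ℝ) ≤ ((n : ℝ) + 1) ^ Fintype.card ι := by
    exact_mod_cast hcount
  have hkn : ((k * n : ℕ) : ℝ) + 1 ≤ (k + 1) * ((n : ℝ) + 1) := by
    push_cast
    have : (0 : ℝ) ≤ k := k.cast_nonneg
    have : (0 : ℝ) ≤ n := n.cast_nonneg
    nlinarith
  calc f (∑ i, x i) ^ n
      = f (∑ e ∈ piAntidiag (univ : Finset ι) n,
          (Nat.multinomial univ e : K) * ∏ i, x i ^ e i) := by
        rw [← map_pow, Finset.sum_pow_eq_sum_piAntidiag]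
    _ ≤ ∑ e ∈ piAntidiag (univ : Finset ι) n,
          f ((Nat.multinomial univ e : K) * ∏ i, x i ^ e i) := f.sum_le _ _
    _ ≤ #(piAntidiag (univ : Finset ι) n) •
          ((((k * n : ℕ) : ℝ) + 1) * N * c ^ (k * n) * B ^ n) := sum_le_card_nsmul _ _ _ hterm
    _ ≤ ((n : ℝ) + 1) ^ Fintype.card ι *
          ((k + 1) * ((n : ℝ) + 1) * N * c ^ (k * n) * B ^ n) := by
        rw [nsmul_eq_mul]
        gcongr
    _ = (k + 1) * N * ((n : ℝ) + 1) ^ (Fintype.card ι + 1) * (c ^ k * B) ^ n := by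
        rw [mul_pow, ← pow_mul]
        ring

lemma AbsoluteValue.det_le {K : Type*} [Field K] (f : AbsoluteValue K ℝ) {N : ℕ} (hN : 1 ≤ N)
    (A : Matrix (Fin N) (Fin N) K) {H : ℝ} (hH : 0 < H) (hA : ∀ i j, f (A i j) ≤ H) :
    f A.det ≤ max 1 (f (N : K)) ^ N * H ^ N := by
  rw [Matrix.det_apply]
  refine f.sum_le_of_card_le_pow hN ?_ _ (by positivity) fun σ => ?_
  · rw [Fintype.card_perm, Fintype.card_fin]
    exact Nat.factorial_le_pow N
  · have hs : f (Equiv.Perm.sign σ • ∏ i, A (σ i) i) = f (∏ i, A (σ i) i) := by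
      rcases Int.units_eq_one_or (Equiv.Perm.sign σ) with h | h <;> simp [h]
    rw [hs, map_prod]
    calc ∏ i, f (A (σ i) i) ≤ ∏ _i : Fin N, H :=
          Finset.prod_le_prod (fun i _ => f.nonneg _) fun i _ => hA _ _
      _ = H ^ N := by simp

lemma AbsoluteValue.adjugate_le {K : Type*} [Field K] (f : AbsoluteValue K ℝ) {N : ℕ}
    (hN : 1 ≤ N) (A : Matrix (Fin N) (Fin N) K) {H : ℝ} (hH : 1 ≤ H)
    (hA : ∀ i j, f (A i j) ≤ H) (i j : Fin N) :
    f (A.adjugate i j) ≤ max 1 (f (N : K)) ^ N * H ^ N := by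
  rw [Matrix.adjugate_apply]
  refine f.det_le hN _ (by linarith) fun k l => ?_
  rw [Matrix.updateRow_apply]
  split_ifs with h
  · rw [Pi.single_apply]
    split_ifs
    · simpa using hH
    · simp only [map_zero]; linarith
  · exact hA k l

lemma le_polyVNorm {K : Type*} [Field K] (f : AbsoluteValue K ℝ) (q : Polynomial K) (j : ℕ) :
    f (q.coeff j) ≤ polyVNorm (fun x => f x) q := by
  by_cases hj : j ∈ q.support
  · have h := Finset.le_sup (f := fun j => (f (q.coeff j)).toNNReal) hj
    exact (Real.le_coe_toNNReal _).trans (NNReal.coe_le_coe.2 h)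
  · rw [Polynomial.notMem_support_iff.1 hj]
    simp

lemma polyVNorm_le {K : Type*} [Field K] (f : AbsoluteValue K ℝ) (q : Polynomial K) {B : ℝ}
    (hB : 0 ≤ B) (h : ∀ j, f (q.coeff j) ≤ B) : (polyVNorm (fun x => f x) q : ℝ) ≤ B := by
  lift B to NNReal using hB
  rw [NNReal.coe_le_coe]
  exact Finset.sup_le fun j _ => Real.toNNReal_le_iff_le_coe.2 (h j)

open Polynomial in
/-- Surjectivity of the Sylvester map: coprime polynomials of maximal degree `D` represent
every polynomial of degree less than `2D` with cofactors of degree less than `D`. -/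
lemma Polynomial.exists_sum_mul_eq_of_degree_lt {K : Type*} [Field K] {M : ℕ}
    (ψ : Fin M → K[X]) (hgcd : ∀ p : K[X], (∀ i, p ∣ ψ i) → IsUnit p) {D : ℕ} (hD1 : 1 ≤ D)
    (hle : ∀ i, (ψ i).natDegree ≤ D) {i₀ : Fin M} (hi₀ : (ψ i₀).natDegree = D)
    (p : K[X]) (hp : p.degree < (2 * D : ℕ)) :
    ∃ g : Fin M → K[X], (∀ i, (g i).degree < D) ∧ p = ∑ i, ψ i * g i := by
  classical
  have hψ₀ : ψ i₀ ≠ 0 := by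
    intro h
    rw [h, natDegree_zero] at hi₀
    omega
  have hdeg₀ : (ψ i₀).degree = D := by rw [degree_eq_natDegree hψ₀, hi₀]
  have htop : Ideal.span (Set.range ψ) = ⊤ := by
    obtain ⟨d, hd⟩ := (IsPrincipalIdealRing.principal (Ideal.span (Set.range ψ))).principal
    rw [hd]
    refine Ideal.span_singleton_eq_top.2 (hgcd d fun i => ?_)
    rw [← Ideal.mem_span_singleton]
    have : ψ i ∈ Ideal.span (Set.range ψ) := Ideal.subset_span ⟨i, rfl⟩
    rwa [hd] at this
  have hmem : p ∈ Ideal.span (Set.range ψ) := htop ▸ Submodule.mem_top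
  obtain ⟨u, hu⟩ := Ideal.mem_span_range_iff_exists_fun.1 hmem
  have hrest : ∀ q : Fin M → K[X], ∑ i, ψ i * q i =
      ψ i₀ * q i₀ + ∑ i ∈ Finset.univ.erase i₀, ψ i * q i := fun q =>
    (Finset.add_sum_erase _ _ (Finset.mem_univ i₀)).symm
  set w : K[X] := u i₀ + ∑ i ∈ Finset.univ.erase i₀, ψ i * (u i / ψ i₀) with hw
  set g : Fin M → K[X] := fun i => if i = i₀ then w else u i % ψ i₀ with hg
  have hg0 : g i₀ = w := by simp [hg]
  have hgi : ∀ i ∈ Finset.univ.erase i₀, g i = u i % ψ i₀ := fun i hi => by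
    simp [hg, Finset.ne_of_mem_erase hi]
  have hsum : p = ∑ i, ψ i * g i := by
    rw [hrest, hg0, Finset.sum_congr rfl fun i hi => by rw [hgi i hi], hw, mul_add,
      Finset.mul_sum, add_assoc, ← Finset.sum_add_distrib, ← hu]
    simp_rw [mul_comm (u _)]
    rw [hrest]
    congr 1
    refine Finset.sum_congr rfl fun i _ => ?_
    conv_lhs => rw [← EuclideanDomain.div_add_mod (u i) (ψ i₀)]
    ring
  have hlt : ∀ i ∈ Finset.univ.erase i₀, (g i).degree < D := fun i hi => by
    rw [hgi i hi, ← hdeg₀]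
    exact EuclideanDomain.mod_lt _ hψ₀
  refine ⟨g, fun i => ?_, hsum⟩
  by_cases hi : i = i₀
  · subst hi
    have heq : ψ i * g i = p - ∑ j ∈ Finset.univ.erase i, ψ j * g j := by
      rw [hsum, hrest, add_sub_cancel_right]
    have hlt' : (ψ i * g i).degree < (2 * D : ℕ) := by
      rw [heq]
      rw [← mem_degreeLT] at hp ⊢
      refine Submodule.sub_mem _ hp (Submodule.sum_mem _ fun j hj => ?_)
      rw [mem_degreeLT]
      by_cases hz : g j = 0
      · rw [hz, mul_zero, degree_zero]
        exact WithBot.bot_lt_coe _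
      · have hj' := hlt j hj
        rw [← natDegree_lt_iff_degree_lt hz] at hj'
        refine (degree_le_natDegree).trans_lt (Nat.cast_lt.2 ?_)
        have := natDegree_mul_le (p := ψ j) (q := g j)
        have := hle j
        omega
    by_cases hz : g i = 0
    · rw [hz, degree_zero]
      exact WithBot.bot_lt_coe _
    · rw [← natDegree_lt_iff_degree_lt hz]
      rw [← natDegree_lt_iff_degree_lt (mul_ne_zero hψ₀ hz), natDegree_mul hψ₀ hz] at hlt'
      omega
  · exact hlt i (Finset.mem_erase.2 ⟨hi, Finset.mem_univ _⟩)

open Polynomial in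
/-- A nonvanishing maximal minor of the Sylvester-type matrix of a coprime family. -/
lemma Polynomial.exists_sylvester_minor_ne_zero {K : Type*} [Field K] {M : ℕ}
    (ψ : Fin M → K[X]) (hgcd : ∀ p : K[X], (∀ i, p ∣ ψ i) → IsUnit p) {D : ℕ} (hD1 : 1 ≤ D)
    (hle : ∀ i, (ψ i).natDegree ≤ D) {i₀ : Fin M} (hi₀ : (ψ i₀).natDegree = D) :
    ∃ e : Fin (2 * D) → Fin M × Fin D, Function.Injective e ∧
      (Matrix.of fun k l : Fin (2 * D) =>
        (ψ (e l).1 * X ^ ((e l).2 : ℕ)).coeff k).det ≠ 0 := by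
  classical
  set col : Fin M × Fin D → Fin (2 * D) → K := fun x k => (ψ x.1 * X ^ (x.2 : ℕ)).coeff k
    with hcol
  have hspan : Submodule.span K (Set.range col) = ⊤ := by
    refine Submodule.eq_top_iff'.2 fun b => ?_
    set p : K[X] := ∑ k : Fin (2 * D), C (b k) * X ^ (k : ℕ) with hp
    have hpdeg : p.degree < (2 * D : ℕ) := degree_sum_fin_lt b
    have hpc : ∀ k : Fin (2 * D), p.coeff k = b k := fun k => by
      simp [hp, coeff_X_pow, Fin.val_inj]
    obtain ⟨g, hg, hsum⟩ :=
      Polynomial.exists_sum_mul_eq_of_degree_lt ψ hgcd hD1 hle hi₀ p hpdeg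
    have hgs : ∀ i, g i = ∑ j : Fin D, C ((g i).coeff j) * X ^ (j : ℕ) := fun i => by
      rw [Fin.sum_univ_eq_sum_range (fun j => C ((g i).coeff j) * X ^ j) D]
      exact as_sum_range_C_mul_X_pow' (g i) (by
        by_cases hz : g i = 0
        · rw [hz, natDegree_zero]; omega
        · exact (natDegree_lt_iff_degree_lt hz).2 (hg i))
    have hb : b = ∑ i, ∑ j : Fin D, (g i).coeff j • col (i, j) := by
      ext k
      rw [← hpc k, hsum, finsetSum_coeff, Finset.sum_apply]
      refine Finset.sum_congr rfl fun i _ => ?_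
      conv_lhs => rw [hgs i, Finset.mul_sum, finsetSum_coeff]
      rw [Finset.sum_apply]
      refine Finset.sum_congr rfl fun j _ => ?_
      rw [mul_left_comm, coeff_C_mul]
      rfl
    rw [hb]
    exact Submodule.sum_mem _ fun i _ => Submodule.sum_mem _ fun j _ =>
      Submodule.smul_mem _ _ (Submodule.subset_span ⟨(i, j), rfl⟩)
  obtain ⟨κ, a, ha, hspan', hli⟩ := exists_linearIndependent' K col
  have : Finite κ := Finite.of_injective a ha
  have := Fintype.ofFinite κ
  rw [hspan] at hspan'
  have hcard : Fintype.card (Fin (2 * D)) = Fintype.card κ := by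
    have := finrank_span_eq_card hli
    rw [hspan', finrank_top, Module.finrank_fin_fun] at this
    rw [Fintype.card_fin, this]
  let φ : Fin (2 * D) ≃ κ := Fintype.equivOfCardEq hcard
  refine ⟨a ∘ φ, ha.comp φ.injective, ?_⟩
  have hli' : LinearIndependent K fun l : Fin (2 * D) => col (a (φ l)) :=
    hli.comp φ φ.injective
  have hunit := Matrix.linearIndependent_rows_iff_isUnit (A := Matrix.of fun l => col (a (φ l)))
    |>.1 hli'
  rw [Matrix.isUnit_iff_isUnit_det, ← Matrix.det_transpose] at hunit
  exact hunit.ne_zero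

open Polynomial in
/-- The Cramer rule for the Sylvester-type matrix, in polynomial form. -/
lemma Polynomial.sum_mul_adjugate_eq {K : Type*} [Field K] {M : ℕ} (ψ : Fin M → K[X]) {D : ℕ}
    (hle : ∀ i, (ψ i).natDegree ≤ D) (e : Fin (2 * D) → Fin M × Fin D)
    (he : Function.Injective e) (A : Matrix (Fin (2 * D)) (Fin (2 * D)) K)
    (hA : A = Matrix.of fun k l => (ψ (e l).1 * X ^ ((e l).2 : ℕ)).coeff k)
    (k₀ : Fin (2 * D)) :
    ∑ i, ψ i * ∑ j : Fin D,
      C (Function.extend e (fun l => A.adjugate l k₀) 0 (i, j)) * X ^ (j : ℕ) =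
      C A.det * X ^ (k₀ : ℕ) := by
  classical
  set c := Function.extend e (fun l => A.adjugate l k₀) 0 with hc
  have hsum : ∑ i, ψ i * ∑ j : Fin D, C (c (i, j)) * X ^ (j : ℕ) =
      ∑ l, C (A.adjugate l k₀) * (ψ (e l).1 * X ^ ((e l).2 : ℕ)) := by
    simp_rw [Finset.mul_sum]
    rw [← Fintype.sum_prod_type' (fun i (j : Fin D) => ψ i * (C (c (i, j)) * X ^ (j : ℕ)))]
    symm
    refine Fintype.sum_of_injective e he _ _ (fun x hx => ?_) fun l => ?_
    · rw [hc, Function.extend_apply' _ _ _ (by simpa using hx)]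
      simp
    · rw [Prod.mk.eta, hc, he.extend_apply]
      ring
  rw [hsum]
  ext k
  rw [finsetSum_coeff, coeff_C_mul, coeff_X_pow]
  simp_rw [coeff_C_mul]
  by_cases hk : k < 2 * D
  · have h := congrFun (congrFun A.mul_adjugate ⟨k, hk⟩) k₀
    rw [Matrix.mul_apply, Matrix.smul_apply, Matrix.one_apply, smul_eq_mul] at h
    simp only [Fin.ext_iff] at h
    rw [← h]
    refine Finset.sum_congr rfl fun l _ => ?_
    rw [mul_comm]
    congr 1
    rw [hA]
    rfl
  · rw [if_neg (by omega), mul_zero]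
    refine Finset.sum_eq_zero fun l _ => ?_
    rw [coeff_eq_zero_of_natDegree_lt, mul_zero]
    have h1 := natDegree_mul_le (p := ψ (e l).1) (q := X ^ ((e l).2 : ℕ))
    rw [natDegree_X_pow] at h1
    have := hle (e l).1
    have := (e l).2.isLt
    omega

/-- **Effective Bézout identities with uniform local bounds.**  Let `K` be a number
field (with places `V`, absolute values `absv` and positive weights `n` satisfying the
product formula), and let `ψ₁, …, ψ_M ∈ K[s]` be polynomials, not all zero, whose
greatest common divisor in `K[s]` is `1`.  Let `D = maxᵢ deg(ψᵢ) ≥ 1`.  Then there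
exist `0 < r ≤ 4D`, a nonzero `a ∈ K`, and polynomials `gᵢ, hᵢ ∈ K[s]` of degree at
most `D − 1` with `a·s^{2D−1} = Σᵢ ψᵢ·gᵢ` and `a = Σᵢ ψᵢ·hᵢ`, such that for every
place `v`: `log |a|_v ≤ r·log⁺(maxᵢ ‖ψᵢ‖_v) + r·log⁺ |r|_v`, and likewise
`log ‖gᵢ‖_v` and `log ‖hᵢ‖_v` are bounded by `r·log⁺(maxᵢ ‖ψᵢ‖_v) + r·log⁺ |r|_v`
for every `i` (where the integer `r` is regarded as an element of `K`). -/
theorem effective_bezout_with_local_bounds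
    (K : Type*) [Field K] [NumberField K]
    (V : Type*) (absv : V → AbsoluteValue K ℝ) (n : V → ℝ)
    (hn : ∀ v, 0 < n v)
    (hprod : ∀ x : K, x ≠ 0 → HasSum (fun v => n v * Real.log (absv v x)) 0)
    (M : ℕ) (ψ : Fin M → Polynomial K)
    (hne : ∃ i, ψ i ≠ 0)
    (hgcd : ∀ p : Polynomial K, (∀ i, p ∣ ψ i) → IsUnit p)
    (D : ℕ) (hD : D = Finset.univ.sup fun i => (ψ i).natDegree) (hD1 : 1 ≤ D) :
    ∃ (r : ℕ) (a : K) (g h : Fin M → Polynomial K),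
      0 < r ∧ r ≤ 4 * D ∧ a ≠ 0 ∧
      (∀ i, (g i).natDegree ≤ D - 1) ∧ (∀ i, (h i).natDegree ≤ D - 1) ∧
      Polynomial.C a * Polynomial.X ^ (2 * D - 1) = ∑ i, ψ i * g i ∧
      Polynomial.C a = ∑ i, ψ i * h i ∧
      ∀ v : V,
        (Real.log (absv v a) ≤
            r * max (Real.log
                (((Finset.univ.sup fun i => polyVNorm (fun x => absv v x) (ψ i)) : NNReal) : ℝ)) 0 +
              r * max (Real.log (absv v (r : K))) 0) ∧
        (∀ i, Real.log (polyVNorm (fun x => absv v x) (g i) : ℝ) ≤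
            r * max (Real.log
                (((Finset.univ.sup fun i => polyVNorm (fun x => absv v x) (ψ i)) : NNReal) : ℝ)) 0 +
              r * max (Real.log (absv v (r : K))) 0) ∧
        (∀ i, Real.log (polyVNorm (fun x => absv v x) (h i) : ℝ) ≤
            r * max (Real.log
                (((Finset.univ.sup fun i => polyVNorm (fun x => absv v x) (ψ i)) : NNReal) : ℝ)) 0 +
              r * max (Real.log (absv v (r : K))) 0) := by
  
  classical
  obtain ⟨i₁, _⟩ := hne
  have hle : ∀ i, (ψ i).natDegree ≤ D := fun i => by
    rw [hD]
    exact Finset.le_sup (f := fun i => (ψ i).natDegree) (Finset.mem_univ i)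
  obtain ⟨i₀, -, hi₀⟩ := Finset.exists_mem_eq_sup Finset.univ ⟨i₁, Finset.mem_univ _⟩
    fun i => (ψ i).natDegree
  rw [← hD] at hi₀
  obtain ⟨e, he, hdet⟩ :=
    Polynomial.exists_sylvester_minor_ne_zero ψ hgcd hD1 hle hi₀.symm
  set A : Matrix (Fin (2 * D)) (Fin (2 * D)) K := Matrix.of fun k l =>
    (ψ (e l).1 * Polynomial.X ^ ((e l).2 : ℕ)).coeff k with hA
  have hcramer := Polynomial.sum_mul_adjugate_eq ψ hle e he A hA
  set G : Fin (2 * D) → Fin M → Polynomial K := fun k₀ i => ∑ j : Fin D, Polynomial.C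
    (Function.extend e (fun l => A.adjugate l k₀) 0 (i, j)) * Polynomial.X ^ (j : ℕ) with hG
  have hGdeg : ∀ k₀ i, (G k₀ i).natDegree ≤ D - 1 := fun k₀ i =>
    Polynomial.natDegree_sum_le_of_forall_le _ _ fun j _ =>
      (Polynomial.natDegree_C_mul_X_pow_le _ _).trans (by omega)
  refine ⟨2 * D, A.det, G ⟨2 * D - 1, by omega⟩, G ⟨0, by omega⟩, by omega, by omega, hdet,
    hGdeg _, hGdeg _, (hcramer ⟨2 * D - 1, by omega⟩).symm, ?_, fun v => ?_⟩
  · simpa using (hcramer ⟨0, by omega⟩).symm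
  set S : NNReal := Finset.univ.sup fun i => polyVNorm (fun x => absv v x) (ψ i) with hS
  have hN : 1 ≤ 2 * D := by omega
  have hH1 : 1 ≤ max 1 (S : ℝ) := le_max_left _ _
  have hentry : ∀ k l, absv v (A k l) ≤ max 1 (S : ℝ) := fun k l => by
    rw [hA, Matrix.of_apply, Polynomial.coeff_mul_X_pow']
    split_ifs
    · refine (le_polyVNorm (absv v) _ _).trans (le_max_of_le_right (NNReal.coe_le_coe.2 ?_))
      exact Finset.le_sup (f := fun i => polyVNorm (fun x => absv v x) (ψ i)) (Finset.mem_univ _)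
    · simp only [map_zero]
      linarith
  have hbound : Real.log (max 1 (absv v ((2 * D : ℕ) : K)) ^ (2 * D) * max 1 (S : ℝ) ^ (2 * D)) =
      (2 * D : ℕ) * max (Real.log S) 0 +
        (2 * D : ℕ) * max (Real.log (absv v ((2 * D : ℕ) : K))) 0 := by
    rw [Real.log_mul (by positivity) (by positivity), Real.log_pow, Real.log_pow,
      ← Real.posLog_eq_log_max_one ((absv v).nonneg _),
      ← Real.posLog_eq_log_max_one S.coe_nonneg, Real.posLog, Real.posLog,
      max_comm 0, max_comm 0, add_comm]
  have hpoly : ∀ k₀ i, Real.log (polyVNorm (fun x => absv v x) (G k₀ i) : ℝ) ≤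
      (2 * D : ℕ) * max (Real.log S) 0 +
        (2 * D : ℕ) * max (Real.log (absv v ((2 * D : ℕ) : K))) 0 := fun k₀ i => by
    rcases (polyVNorm (fun x => absv v x) (G k₀ i)).coe_nonneg.eq_or_lt with h0 | h0
    · rw [← h0, Real.log_zero]
      positivity
    rw [← hbound]
    refine Real.log_le_log h0 (polyVNorm_le _ _ (by positivity) fun m => ?_)
    by_cases hm : m < D
    · have hcoeff : (G k₀ i).coeff m =
          Function.extend e (fun l => A.adjugate l k₀) 0 (i, ⟨m, hm⟩) := by
        rw [hG]
        simp only [Polynomial.finsetSum_coeff, Polynomial.coeff_C_mul, Polynomial.coeff_X_pow]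
        rw [Finset.sum_eq_single ⟨m, hm⟩]
        · simp
        · intro j _ hj
          rw [if_neg fun h => hj (Fin.ext h.symm), mul_zero]
        · simp
      rw [hcoeff]
      by_cases hx : ∃ l, e l = (i, ⟨m, hm⟩)
      · obtain ⟨l, hl⟩ := hx
        rw [← hl, he.extend_apply]
        exact (absv v).adjugate_le hN A hH1 hentry l k₀
      · rw [Function.extend_apply' _ _ _ hx, Pi.zero_apply, map_zero]
        positivity
    · rw [Polynomial.coeff_eq_zero_of_natDegree_lt (by have := hGdeg k₀ i; omega), map_zero]
      positivity
  refine ⟨?_, fun i => hpoly _ i, fun i => hpoly _ i⟩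
  rw [← hbound]
  exact Real.log_le_log ((absv v).pos hdet) ((absv v).det_le hN A (by linarith) hentry)
end
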